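/- arXiv:2410.23026 — 3 statements merged into one kernel-verified Lean document; each statement's English description precedes it below -/
import Mathlib

section
/- Let m₁ and m₂ be positive integers and let s be a nonnegative real number. Then the segments Δ((1−m₁)/2 + s, m₁) and Δ((1−m₂)/2 − s, m₂) are linked if and only if there exists a natural number i with i ≤ min(m₁, m₂) − 1 such that s = (m₁+m₂)/4 − i/2. -/
/-- The Zelevinsky segment `Δ(a, len) = {a, a+1, …, a+len-1} ⊆ ℝ`. -/
def seg (a : ℝ) (len : ℕ) : Set ℝ := {x | ∃ j : ℕ, j < len ∧ x = a + j}

/-- Two segments are linked (in the sense of Zelevinsky) if neither contains the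
other and their union is again a segment. -/
def IsLinked (Δ Δ' : Set ℝ) : Prop :=
  ¬ Δ ⊆ Δ' ∧ ¬ Δ' ⊆ Δ ∧ ∃ (b : ℝ) (len : ℕ), Δ ∪ Δ' = seg b len

theorem add_natCast_mem_seg {c : ℝ} {j m n : ℕ} :
    c + n ∈ seg (c + j) m ↔ j ≤ n ∧ n < j + m := by
  constructor
  · rintro ⟨i, hi, h⟩
    have h' : n = j + i := by
      have : (n : ℝ) = j + i := by linarith
      exact_mod_cast this
    omega
  · rintro ⟨h, h'⟩
    refine ⟨n - j, by omega, ?_⟩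
    rw [Nat.cast_sub h]
    ring

theorem exists_of_mem_seg {c x : ℝ} {j m : ℕ} (h : x ∈ seg (c + j) m) :
    ∃ n : ℕ, x = c + n := by
  obtain ⟨i, -, rfl⟩ := h
  exact ⟨j + i, by push_cast; ring⟩

theorem seg_subset_seg_iff {c : ℝ} {j m k m' : ℕ} (hm : 0 < m) :
    seg (c + j) m ⊆ seg (c + k) m' ↔ k ≤ j ∧ j + m ≤ k + m' := by
  constructor
  · intro h
    have h₁ := add_natCast_mem_seg.1 (h (add_natCast_mem_seg.2 ⟨le_refl j, by omega⟩))
    have h₂ := add_natCast_mem_seg.1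
      (h ((add_natCast_mem_seg (n := j + m - 1)).2 ⟨by omega, by omega⟩))
    omega
  · intro h x hx
    obtain ⟨n, rfl⟩ := exists_of_mem_seg hx
    rw [add_natCast_mem_seg] at hx ⊢
    omega

/-- The union of two segments on a common lattice is a segment as soon as the first starts no later
than the second, ends no later than it, and leaves no gap before it. -/
theorem seg_union_seg {c : ℝ} {j m k m' : ℕ} (h₁ : j ≤ k) (h₂ : k ≤ j + m)
    (h₃ : j + m ≤ k + m') :
    seg (c + j) m ∪ seg (c + k) m' = seg (c + j) (k + m' - j) := by
  ext x
  constructor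
  · rintro (hx | hx) <;> obtain ⟨n, rfl⟩ := exists_of_mem_seg hx <;>
      rw [add_natCast_mem_seg] at hx ⊢ <;> omega
  · intro hx
    obtain ⟨n, rfl⟩ := exists_of_mem_seg hx
    rw [Set.mem_union, add_natCast_mem_seg, add_natCast_mem_seg]
    rw [add_natCast_mem_seg] at hx
    omega

theorem le_add_of_seg_union_seg_eq {b c : ℝ} {j m k m' len : ℕ} (hm : 0 < m) (hm' : 0 < m')
    (h : seg (c + j) m ∪ seg (c + k) m' = seg b len) : k ≤ j + m := by
  have hlen : 0 < len := by
    obtain ⟨i, hi, -⟩ : c + j ∈ seg b len :=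
      h ▸ Or.inl (add_natCast_mem_seg.2 ⟨le_rfl, by omega⟩)
    omega
  obtain ⟨l, rfl⟩ : ∃ l : ℕ, b = c + l := by
    have hb : b ∈ seg (c + j) m ∪ seg (c + k) m' := h ▸ ⟨0, hlen, by simp⟩
    exact hb.elim exists_of_mem_seg exists_of_mem_seg
  have key (n : ℕ) : (j ≤ n ∧ n < j + m ∨ k ≤ n ∧ n < k + m') ↔ l ≤ n ∧ n < l + len := by
    simpa only [Set.mem_union, add_natCast_mem_seg] using Set.ext_iff.1 h (c + n)
  have h₁ := key j
  have h₂ := key (j + m)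
  have h₃ := key k
  omega

theorem isLinked_seg_iff {c : ℝ} {j m k m' : ℕ} (hm : 0 < m) (hm' : 0 < m') :
    IsLinked (seg (c + j) m) (seg (c + k) m') ↔
      (j < k ∧ k ≤ j + m ∧ j + m < k + m') ∨ (k < j ∧ j ≤ k + m' ∧ k + m' < j + m) := by
  rw [IsLinked, seg_subset_seg_iff hm, seg_subset_seg_iff hm']
  constructor
  · rintro ⟨h₁, h₂, b, len, h⟩
    have h₃ := le_add_of_seg_union_seg_eq hm hm' h
    have h₄ := le_add_of_seg_union_seg_eq hm' hm (Set.union_comm _ _ ▸ h)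
    omega
  · rintro (h | h)
    · exact ⟨by omega, by omega, _, _, seg_union_seg (by omega) (by omega) (by omega)⟩
    · exact ⟨by omega, by omega, _, _, (Set.union_comm _ _).trans
        (seg_union_seg (by omega) (by omega) (by omega))⟩

theorem exists_eq_add_of_seg_subset_seg {a c : ℝ} {m len : ℕ} (hm : 0 < m)
    (h : seg a m ⊆ seg c len) : ∃ j : ℕ, a = c + j := by
  obtain ⟨j, -, hj⟩ : a ∈ seg c len := h ⟨0, hm, by simp⟩
  exact ⟨j, hj⟩

theorem linked_iff_pole (m₁ m₂ : ℕ) (h₁ : 0 < m₁) (h₂ : 0 < m₂) (s : ℝ) (hs : 0 ≤ s) :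
    IsLinked (seg ((1 - (m₁ : ℝ)) / 2 + s) m₁) (seg ((1 - (m₂ : ℝ)) / 2 - s) m₂) ↔
      ∃ i : ℕ, i ≤ min m₁ m₂ - 1 ∧ s = ((m₁ : ℝ) + m₂) / 4 - i / 2 := by
  constructor
  · intro hl
    obtain ⟨c, len, h⟩ := hl.2.2
    obtain ⟨j, hj⟩ := exists_eq_add_of_seg_subset_seg h₁ (h ▸ Set.subset_union_left)
    obtain ⟨k, hk⟩ := exists_eq_add_of_seg_subset_seg h₂ (h ▸ Set.subset_union_right)
    rw [hj, hk] at hl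
    rw [isLinked_seg_iff h₁ h₂] at hl
    -- the midpoint of the first segment is not to the left of that of the second
    have hmid : 2 * k + m₂ ≤ 2 * j + m₁ := by
      have : (2 * k + m₂ : ℝ) ≤ 2 * j + m₁ := by linarith
      exact_mod_cast this
    refine ⟨k + m₂ - j, by omega, ?_⟩
    rw [Nat.cast_sub (by omega)]
    push_cast
    linarith
  · rintro ⟨i, hi, rfl⟩
    set c : ℝ := (1 - (m₂ : ℝ)) / 2 - (((m₁ : ℝ) + m₂) / 4 - i / 2) with hc
    have hj : (1 - (m₁ : ℝ)) / 2 + (((m₁ : ℝ) + m₂) / 4 - i / 2) = c + (m₂ - i : ℕ) := by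
      rw [Nat.cast_sub (by omega), hc]
      ring
    have hk : c = c + (0 : ℕ) := by simp
    rw [hj]
    nth_rewrite 2 [hk]
    rw [isLinked_seg_iff h₁ h₂]
    omega
end

section
/- Let α be an ℓ×ℓ matrix over F such that α i j = 0 whenever d i − d j ≠ −2 (equivalently, conjugation by h(t) = diag(t^{d 1},…,t^{d ℓ}) scales α by t⁻²). Then the map b : N_{≥2}(d) → F defined by b(x) = trace(α·(x − 1)) satisfies b(x·y) = b(x) + b(y) for all x, y ∈ N_{≥2}(d); in particular b is a group homomorphism from N_{≥2}(d) to the additive group of F, and b vanishes on every commutator x·y·x⁻¹·y⁻¹ with x, y ∈ N_{≥2}(d). -/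
/-- The unipotent subgroup `N_{≥w}(d)`. -/
def Nge (F : Type*) [Field F] {ℓ : ℕ} (d : Fin ℓ → ℤ) (w : ℤ) :
    Set (Matrix (Fin ℓ) (Fin ℓ) F) :=
  {x | (∀ i, x i i = 1) ∧ ∀ i j, i ≠ j → d i - d j < w → x i j = 0}

/-- The map `b(x) = tr(α · (x - 1))` of equation (1.11). -/
def bmap {F : Type*} [Field F] {ℓ : ℕ} (α x : Matrix (Fin ℓ) (Fin ℓ) F) : F :=
  Matrix.trace (α * (x - 1))

/-- The matrices of weight at least `w` under conjugation by `diag(t^{d 1}, …, t^{d ℓ})`. -/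
def WeightGE {F : Type*} [Field F] {ℓ : ℕ} (d : Fin ℓ → ℤ) (w : ℤ)
    (A : Matrix (Fin ℓ) (Fin ℓ) F) : Prop :=
  ∀ i j, d i - d j < w → A i j = 0

section

variable {F : Type*} [Field F] {ℓ : ℕ} {d : Fin ℓ → ℤ}

theorem WeightGE.mul {v w : ℤ} {A B : Matrix (Fin ℓ) (Fin ℓ) F}
    (hA : WeightGE d v A) (hB : WeightGE d w B) : WeightGE d (v + w) (A * B) := by
  intro i j hij
  rw [Matrix.mul_apply]
  refine Finset.sum_eq_zero fun k _ => ?_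
  by_cases hik : d i - d k < v
  · rw [hA i k hik, zero_mul]
  · rw [hB k j (by lia), mul_zero]

theorem WeightGE.sub {w : ℤ} {A B : Matrix (Fin ℓ) (Fin ℓ) F}
    (hA : WeightGE d w A) (hB : WeightGE d w B) : WeightGE d w (A - B) := by
  intro i j hij
  rw [Matrix.sub_apply, hA i j hij, hB i j hij, sub_zero]

theorem weightGE_sub_one {w : ℤ} {x : Matrix (Fin ℓ) (Fin ℓ) F} (hx : x ∈ Nge F d w) :
    WeightGE d w (x - 1) := by
  intro i j hij
  rcases eq_or_ne i j with rfl | h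
  · simp [hx.1 i]
  · simp [hx.2 i j h hij, h]

theorem blockTriangular_neg_iff {x : Matrix (Fin ℓ) (Fin ℓ) F} :
    x.BlockTriangular (fun i => -d i) ↔ WeightGE d 0 x :=
  ⟨fun h i j hij => h (show -d j < -d i by lia),
    fun h i j (hij : -d j < -d i) => h i j (by lia)⟩

theorem weightGE_zero_of_mem_Nge {w : ℤ} (hw : 0 ≤ w) {x : Matrix (Fin ℓ) (Fin ℓ) F}
    (hx : x ∈ Nge F d w) : WeightGE d 0 x :=
  fun i j hij => hx.2 i j (by rintro rfl; simp at hij) (hij.trans_le hw)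

theorem det_eq_one_of_mem_Nge {w : ℤ} (hw : 0 < w) {x : Matrix (Fin ℓ) (Fin ℓ) F}
    (hx : x ∈ Nge F d w) : x.det = 1 := by
  rw [(blockTriangular_neg_iff.2 (weightGE_zero_of_mem_Nge hw.le hx)).det]
  refine Finset.prod_eq_one fun a _ => ?_
  suffices x.toSquareBlock (fun i => -d i) a = 1 by rw [this, Matrix.det_one]
  ext ⟨i, hi⟩ ⟨j, hj⟩
  rcases eq_or_ne i j with rfl | h
  · simp [Matrix.toSquareBlock_def, hx.1 i]
  · simp [Matrix.toSquareBlock_def, h, hx.2 i j h (by lia)]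

theorem weightGE_zero_inv {w : ℤ} (hw : 0 < w) {x : Matrix (Fin ℓ) (Fin ℓ) F}
    (hx : x ∈ Nge F d w) : WeightGE d 0 x⁻¹ := by
  have : Invertible x := x.invertibleOfIsUnitDet (by simp [det_eq_one_of_mem_Nge hw hx])
  exact blockTriangular_neg_iff.1 (Matrix.blockTriangular_inv_of_blockTriangular
    (blockTriangular_neg_iff.2 (weightGE_zero_of_mem_Nge hw.le hx)))

theorem trace_mul_eq_zero_of_weightGE {w : ℤ} (hw : 2 < w) {α A : Matrix (Fin ℓ) (Fin ℓ) F}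
    (hα : ∀ i j, d i - d j ≠ -2 → α i j = 0) (hA : WeightGE d w A) :
    Matrix.trace (α * A) = 0 := by
  refine Finset.sum_eq_zero fun i _ => ?_
  rw [Matrix.diag_apply, Matrix.mul_apply]
  refine Finset.sum_eq_zero fun j _ => ?_
  by_cases h : d i - d j = -2
  · rw [hA j i (by lia), mul_zero]
  · rw [hα i j h, zero_mul]

end

theorem bmap_add_hom (F : Type*) [Field F] (ℓ : ℕ) (hℓ : 0 < ℓ) (d : Fin ℓ → ℤ)
    (α : Matrix (Fin ℓ) (Fin ℓ) F)
    (hα : ∀ i j, d i - d j ≠ -2 → α i j = 0) :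
    (∀ x ∈ Nge F d 2, ∀ y ∈ Nge F d 2, bmap α (x * y) = bmap α x + bmap α y) ∧
    (∀ x ∈ Nge F d 2, ∀ y ∈ Nge F d 2, bmap α (x * y * x⁻¹ * y⁻¹) = 0) := by
  constructor
  · intro x hx y hy
    have hxy : x * y - 1 = (x - 1) + (y - 1) + (x - 1) * (y - 1) := by noncomm_ring
    have h := trace_mul_eq_zero_of_weightGE (by norm_num) hα
      ((weightGE_sub_one hx).mul (weightGE_sub_one hy))
    rw [bmap, hxy, mul_add, mul_add, Matrix.trace_add, Matrix.trace_add, h, add_zero]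
    rfl
  · intro x hx y hy
    have hxu : IsUnit x.det := by simp [det_eq_one_of_mem_Nge two_pos hx]
    have hyu : IsUnit y.det := by simp [det_eq_one_of_mem_Nge two_pos hy]
    have hcomm : x * y * x⁻¹ * y⁻¹ - 1 =
        ((x - 1) * (y - 1) - (y - 1) * (x - 1)) * x⁻¹ * y⁻¹ := by
      have h : (x - 1) * (y - 1) - (y - 1) * (x - 1) = x * y - y * x := by noncomm_ring
      rw [h, sub_mul, sub_mul, Matrix.mul_nonsing_inv_cancel_right x y hxu,
        Matrix.mul_nonsing_inv y hyu]
    rw [bmap, hcomm]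
    have hX := weightGE_sub_one hx
    have hY := weightGE_sub_one hy
    exact trace_mul_eq_zero_of_weightGE (by norm_num) hα
      ((((hX.mul hY).sub (hY.mul hX)).mul (weightGE_zero_inv two_pos hx)).mul
        (weightGE_zero_inv two_pos hy))
end

section
/- Let F be a field, let k ≥ 2 and r ≥ 2 be integers, and set ℓ = k·r. Let α be the ℓ×ℓ matrix over F written in block form with diagonal block sizes (1, r, r, …, r, r−1), where there are k−1 blocks of size r, whose only nonzero blocks are: the (2,1) block, equal to the r×1 column vector (0,…,0,1)ᵀ; the (i+1, i) block, equal to the identity matrix I_r, for each i with 2 ≤ i ≤ k−1; and the (k+1, k) block, equal to the (r−1)×r matrix whose first r−1 columns form I_{r−1} and whose last column is (1,0,…,0)ᵀ. Then α is conjugate in GL_ℓ(F) to the block-diagonal nilpotent matrix diag(J_{k+1}, J_k, …, J_k, J_{k−1}) with r−2 copies of J_k; equivalently, α is nilpotent of Jordan type (k+1, k^{r−2}, k−1), i.e., rank(α^j) = max(k+1−j, 0) + (r−2)·max(k−j, 0) + max(k−1−j, 0) for every integer j ≥ 1. -/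
/-- The nilpotent matrix `α` of the Whittaker pair arising from the Fourier
coefficient (1.63): in block form with diagonal block sizes `(1, r, …, r, r-1)`
(with `k-1` blocks of size `r`), the nonzero blocks are the `(2,1)` block
`(0,…,0,1)ᵀ`, the `(i+1,i)` blocks `I_r` for `2 ≤ i ≤ k-1`, and the `(k+1,k)`
block whose first `r-1` columns form `I_{r-1}` and whose last column is
`(1,0,…,0)ᵀ`.  Entrywise: `α p q = 1` iff `p = r ∧ q = 0`, or
`r+1 ≤ p ∧ p = q + r`, or `p = 1+(k-1)r ∧ q = (k-1)r`. -/
def alphaMat (F : Type*) [Field F] (k r : ℕ) : Matrix (Fin (k * r)) (Fin (k * r)) F :=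
  Matrix.of fun p q =>
    if ((p : ℕ) = r ∧ (q : ℕ) = 0) ∨
       (r + 1 ≤ (p : ℕ) ∧ (p : ℕ) = (q : ℕ) + r) ∨
       ((p : ℕ) = 1 + (k - 1) * r ∧ (q : ℕ) = (k - 1) * r) then 1 else 0

/-- The block-diagonal nilpotent matrix `diag(J_{k+1}, J_k, …, J_k, J_{k-1})`
with `r-2` copies of the lower Jordan block `J_k`: entry `1` at `(q+1, q)`
except when `q+1` is one of the block boundaries `k+1+t·k`, `0 ≤ t ≤ r-2`. -/
def jordanDiagMat (F : Type*) [Field F] (k r : ℕ) :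
    Matrix (Fin (k * r)) (Fin (k * r)) F :=
  Matrix.of fun p q =>
    if (p : ℕ) = (q : ℕ) + 1 ∧ ∀ t < r - 1, (p : ℕ) ≠ k + 1 + t * k then 1 else 0

open Matrix

section BlockShift

variable {ι : Type*} [DecidableEq ι]

theorem sigmaFin_ext_iff {ι : Type*} {s : ι → ℕ} {x y : Σ b, Fin (s b)} :
    x = y ↔ x.1 = y.1 ∧ (x.2 : ℕ) = y.2 := by
  obtain ⟨b, i⟩ := x
  obtain ⟨c, j⟩ := y
  constructor
  · intro h
    cases h
    simp
  · rintro ⟨h, hij⟩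
    dsimp only at h hij
    subst h
    rw [Fin.ext hij]

/-- The `j`-th power of the block-diagonal matrix whose blocks are lower Jordan blocks of
sizes `s b`. -/
def blockShift (F : Type*) [Field F] (s : ι → ℕ) (j : ℕ) :
    Matrix (Σ b, Fin (s b)) (Σ b, Fin (s b)) F :=
  Matrix.of fun x y => if x.1 = y.1 ∧ (x.2 : ℕ) = y.2 + j then 1 else 0

variable (F : Type*) [Field F] (s : ι → ℕ)

theorem blockShift_zero : blockShift F s 0 = 1 := by
  ext x y
  simp only [blockShift, of_apply, Matrix.one_apply, add_zero, sigmaFin_ext_iff]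

variable [Fintype ι]

theorem mul_blockShift_apply {m : Type*} (M : Matrix m (Σ b, Fin (s b)) F) (p : m)
    (y : Σ b, Fin (s b)) (j : ℕ) :
    (M * blockShift F s j) p y =
      if h : (y.2 : ℕ) + j < s y.1 then M p ⟨y.1, ⟨y.2 + j, h⟩⟩ else 0 := by
  rw [Matrix.mul_apply]
  split_ifs with h
  · rw [Finset.sum_eq_single ⟨y.1, ⟨y.2 + j, h⟩⟩]
    · simp [blockShift]
    · intro x _ hx
      rw [ne_eq, sigmaFin_ext_iff] at hx
      simp only [blockShift, of_apply]
      rw [if_neg hx, mul_zero]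
    · simp
  · refine Finset.sum_eq_zero fun x _ => ?_
    have : ¬ (x.1 = y.1 ∧ (x.2 : ℕ) = y.2 + j) := by
      rintro ⟨h1, h2⟩
      have := x.2.isLt
      have := congrArg s h1
      omega
    simp only [blockShift, of_apply]
    rw [if_neg this, mul_zero]

theorem blockShift_mul (i j : ℕ) :
    blockShift F s i * blockShift F s j = blockShift F s (i + j) := by
  ext x y
  rw [mul_blockShift_apply]
  split_ifs with h
  · simp only [blockShift, of_apply]
    congr 2
    rw [eq_iff_iff]
    constructor <;> intro h <;> omega
  · simp only [blockShift, of_apply]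
    rw [if_neg]
    rintro ⟨h1, h2⟩
    have := x.2.isLt
    have := congrArg s h1
    omega

theorem blockShift_one_pow (j : ℕ) : blockShift F s 1 ^ j = blockShift F s j := by
  induction j with
  | zero => rw [pow_zero, blockShift_zero]
  | succ j ih => rw [pow_succ, ih, blockShift_mul]

theorem blockShift_mul_transpose (j : ℕ) :
    blockShift F s j * (blockShift F s j)ᵀ =
      diagonal fun x : Σ b, Fin (s b) => if j ≤ (x.2 : ℕ) then (1 : F) else 0 := by
  ext x y
  rw [Matrix.mul_apply]
  by_cases hx : j ≤ (x.2 : ℕ)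
  · rw [Finset.sum_eq_single ⟨x.1, ⟨x.2 - j, by have := x.2.isLt; omega⟩⟩]
    · simp only [blockShift, of_apply, transpose_apply, diagonal_apply, sigmaFin_ext_iff]
      have e : (x.2 : ℕ) - j + j = x.2 := by omega
      simp only [e, hx, and_self, if_true, one_mul]
      congr 1
      rw [eq_iff_iff, eq_comm, @eq_comm _ (y.2 : ℕ)]
    · intro z _ hz
      rw [ne_eq, sigmaFin_ext_iff] at hz
      simp only [blockShift, of_apply, transpose_apply]
      rw [if_neg, zero_mul]
      rintro ⟨h1, h2⟩
      exact hz ⟨h1.symm, by dsimp only; omega⟩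
    · simp
  · simp only [diagonal_apply, if_neg hx, ite_self]
    refine Finset.sum_eq_zero fun z _ => ?_
    simp only [blockShift, of_apply]
    rw [if_neg (by omega), zero_mul]

theorem diagonal_mul_blockShift (j : ℕ) :
    (diagonal fun x : Σ b, Fin (s b) => if j ≤ (x.2 : ℕ) then (1 : F) else 0) *
      blockShift F s j = blockShift F s j := by
  ext x y
  rw [diagonal_mul]
  simp only [blockShift, of_apply]
  by_cases hx : j ≤ (x.2 : ℕ)
  · simp [hx]
  · rw [if_neg hx, zero_mul, if_neg (by omega)]

theorem card_filter_le_fin (n j : ℕ) :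
    (Finset.univ.filter fun i : Fin n => j ≤ (i : ℕ)).card = n - j := by
  have h : (Finset.univ.filter fun i : Fin n => j ≤ (i : ℕ)).map Fin.valEmbedding =
      Finset.Ico j n := by
    ext a
    simp only [Finset.mem_map, Finset.mem_filter, Finset.mem_univ, true_and,
      Fin.valEmbedding_apply, Finset.mem_Ico]
    exact ⟨by rintro ⟨i, hi, rfl⟩; exact ⟨hi, i.isLt⟩, fun h => ⟨⟨a, h.2⟩, h.1, rfl⟩⟩
  rw [← Finset.card_map Fin.valEmbedding, h, Nat.card_Ico]

theorem rank_blockShift (j : ℕ) : (blockShift F s j).rank = ∑ b, (s b - j) := by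
  have h1 := blockShift_mul_transpose F s j
  have h2 := diagonal_mul_blockShift F s j
  have h3 : (blockShift F s j).rank = (diagonal fun x : Σ b, Fin (s b) =>
      if j ≤ (x.2 : ℕ) then (1 : F) else 0).rank := by
    apply le_antisymm
    · conv_lhs => rw [← h2]
      exact rank_mul_le_left _ _
    · rw [← h1]
      exact rank_mul_le_left _ _
  classical
  rw [h3, rank_diagonal, Fintype.card_subtype, Finset.card_filter, Fintype.sum_sigma]
  refine Finset.sum_congr rfl fun b _ => ?_
  rw [← card_filter_le_fin, Finset.card_filter]
  simp

end BlockShift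

theorem mul_add_inj_of_lt {r i c i' c' : ℕ} (hc : c < r) (hc' : c' < r) :
    i * r + c = i' * r + c' ↔ i = i' ∧ c = c' := by
  constructor
  · intro h
    rcases lt_trichotomy i i' with hi | rfl | hi
    · have := Nat.mul_le_mul_right r (Nat.succ_le_of_lt hi)
      rw [Nat.succ_mul] at this
      omega
    · omega
    · have := Nat.mul_le_mul_right r (Nat.succ_le_of_lt hi)
      rw [Nat.succ_mul] at this
      omega
  · rintro ⟨rfl, rfl⟩
    rfl

theorem mul_add_lt_mul {k r i c : ℕ} (hi : i < k) (hc : c < r) : i * r + c < k * r := by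
  have := Nat.mul_le_mul_right r (Nat.succ_le_of_lt hi)
  rw [Nat.succ_mul] at this
  omega

/-- The parts `(k+1, k, …, k, k-1)` of the Jordan type. -/
def jordanSize (k r : ℕ) (b : Fin r) : ℕ :=
  if (b : ℕ) = 0 then k + 1 else if (b : ℕ) = r - 1 then k - 1 else k

theorem sum_jordanSize_sub (k r j : ℕ) (hr : 2 ≤ r) :
    ∑ b, (jordanSize k r b - j) = (k + 1 - j) + (r - 2) * (k - j) + (k - 1 - j) := by
  obtain ⟨m, rfl⟩ := Nat.exists_eq_add_of_le' hr
  rw [Fin.sum_univ_succ, Fin.sum_univ_castSucc]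
  have h : ∀ b : Fin m, jordanSize k (m + 2) b.castSucc.succ = k := by
    intro b
    have := b.isLt
    simp only [jordanSize, Fin.val_succ, Fin.val_castSucc]
    rw [if_neg (by omega), if_neg (by omega)]
  simp only [h]
  simp [jordanSize, add_assoc]

theorem sum_jordanSize (k r : ℕ) (hk : 1 ≤ k) (hr : 2 ≤ r) :
    ∑ b, jordanSize k r b = k * r := by
  have h := sum_jordanSize_sub k r 0 hr
  simp only [Nat.sub_zero] at h
  rw [h]
  obtain ⟨m, rfl⟩ := Nat.exists_eq_add_of_le' hr
  obtain ⟨n, rfl⟩ := Nat.exists_eq_add_of_le' hk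
  simp only [Nat.add_sub_cancel]
  ring

/-- An injection from the Jordan blocks into `Fin (k * r)` is a bijection. -/
theorem exists_equiv_of_jordanSize {k r : ℕ} (hk : 1 ≤ k) (hr : 2 ≤ r)
    (f : (Σ b, Fin (jordanSize k r b)) → ℕ) (hf : ∀ x, f x < k * r)
    (hinj : ∀ x y, f x = f y → x = y) :
    ∃ e : (Σ b, Fin (jordanSize k r b)) ≃ Fin (k * r), ∀ x, (e x : ℕ) = f x := by
  have hb : Function.Bijective fun x => (⟨f x, hf x⟩ : Fin (k * r)) := by
    rw [Fintype.bijective_iff_injective_and_card]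
    refine ⟨fun x y h => hinj x y (congrArg Fin.val h), ?_⟩
    simp [sum_jordanSize k r hk hr]
  exact ⟨Equiv.ofBijective _ hb, fun x => rfl⟩

theorem jordanSize_cases {k r : ℕ} (x : Σ b, Fin (jordanSize k r b)) :
    (x.1 : ℕ) < r ∧ (((x.1 : ℕ) = 0 ∧ (x.2 : ℕ) < k + 1) ∨
      ((x.1 : ℕ) ≠ 0 ∧ (x.1 : ℕ) = r - 1 ∧ (x.2 : ℕ) < k - 1) ∨
      ((x.1 : ℕ) ≠ 0 ∧ (x.1 : ℕ) ≠ r - 1 ∧ (x.2 : ℕ) < k)) := by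
  refine ⟨x.1.isLt, ?_⟩
  have := x.2.isLt
  have h : jordanSize k r x.1 =
      if (x.1 : ℕ) = 0 then k + 1 else if (x.1 : ℕ) = r - 1 then k - 1 else k := rfl
  split_ifs at h <;> omega

theorem exists_equiv_jordanDiagMat (F : Type*) [Field F] {k r : ℕ} (hk : 2 ≤ k) (hr : 2 ≤ r) :
    ∃ e : (Σ b, Fin (jordanSize k r b)) ≃ Fin (k * r),
      (jordanDiagMat F k r).submatrix e e = blockShift F (jordanSize k r) 1 := by
  have key : ∀ b b' i i' : ℕ, i < k → i' < k → (b * k + i = b' * k + i' ↔ b = b' ∧ i = i') :=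
    fun b b' i i' h h' => mul_add_inj_of_lt h h'
  let f : (Σ b, Fin (jordanSize k r b)) → ℕ := fun x =>
    if (x.1 : ℕ) = 0 then (x.2 : ℕ) else x.1 * k + x.2 + 1
  have hlt : ∀ x, f x < k * r := by
    intro x
    obtain ⟨h, h'⟩ := jordanSize_cases x
    have h1 := Nat.mul_le_mul_right k (Nat.succ_le_of_lt h)
    have h2 := Nat.mul_le_mul_right k hr
    rw [Nat.succ_mul, mul_comm r] at h1
    rw [mul_comm r] at h2
    simp only [f]
    split_ifs with h0
    · omega
    · rcases h' with h' | h' | h'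
      · omega
      · omega
      · have h3 : (x.1 : ℕ) + 2 ≤ r := by omega
        have := Nat.mul_le_mul_right k h3
        rw [add_mul, mul_comm r] at this
        omega
  have hinj : ∀ x y, f x = f y → x = y := by
    intro x y hxy
    rw [sigmaFin_ext_iff, Fin.ext_iff]
    obtain ⟨hx, hx'⟩ := jordanSize_cases x
    obtain ⟨hy, hy'⟩ := jordanSize_cases y
    simp only [f] at hxy
    have hp : ∀ b : ℕ, b ≠ 0 → k ≤ b * k := fun b hb =>
      Nat.le_mul_of_pos_left k (Nat.pos_of_ne_zero hb)
    split_ifs at hxy with h1 h2 h2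
    · omega
    · have := hp _ h2
      omega
    · have := hp _ h1
      omega
    · have := key x.1 y.1 x.2 y.2 (by omega) (by omega)
      omega
  obtain ⟨e, he⟩ := exists_equiv_of_jordanSize (by omega) hr f hlt hinj
  refine ⟨e, ?_⟩
  ext x y
  simp only [submatrix_apply, jordanDiagMat, blockShift, of_apply, he, Fin.ext_iff]
  congr 1
  rw [eq_iff_iff]
  obtain ⟨hx, hx'⟩ := jordanSize_cases x
  obtain ⟨hy, hy'⟩ := jordanSize_cases y
  have hp : ∀ b : ℕ, b ≠ 0 → k ≤ b * k := fun b hb =>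
    Nat.le_mul_of_pos_left k (Nat.pos_of_ne_zero hb)
  constructor
  · rintro ⟨h, hb⟩
    have hx0 : (x.1 : ℕ) ≠ 0 → (x.2 : ℕ) ≠ 0 := by
      intro h0 h1
      refine hb (x.1 - 1) (by omega) ?_
      simp only [f]
      rw [if_neg h0, h1]
      have : (x.1 : ℕ) = x.1 - 1 + 1 := by omega
      conv_lhs => rw [this, add_mul]
      omega
    simp only [f] at h
    split_ifs at h with h1 h2 h2
    · omega
    · have := hp _ h2
      omega
    · have := hp _ h1
      have := hx0 h1
      omega
    · have := key x.1 y.1 (x.2 - 1) y.2 (by omega) (by omega)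
      have := hx0 h1
      omega
  · rintro ⟨h1, h2⟩
    simp only [f, h1, h2]
    refine ⟨by split_ifs <;> omega, fun t ht h => ?_⟩
    split_ifs at h with h0
    · omega
    · have := key y.1 (t + 1) (y.2 + 1) 0 (by omega) (by omega)
      rw [add_mul] at this
      omega

/-- The extra entry of `α` beyond its Jordan form, in Jordan coordinates: it maps the last vector
of the block of size `k-1` to the last vector of the block of size `k+1`. -/
def mergeEntry (F : Type*) [Field F] (k r : ℕ) :
    Matrix (Σ b, Fin (jordanSize k r b)) (Σ b, Fin (jordanSize k r b)) F :=
  Matrix.of fun x y =>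
    if ((x.1 : ℕ) = 0 ∧ (x.2 : ℕ) = k) ∧ ((y.1 : ℕ) = r - 1 ∧ (y.2 : ℕ) = k - 2) then 1 else 0

/-- The map sending the `i`-th vector of the block of size `k-1` to the `(i+1)`-st vector of the
block of size `k+1`. -/
def mergeMap (F : Type*) [Field F] (k r : ℕ) :
    Matrix (Σ b, Fin (jordanSize k r b)) (Σ b, Fin (jordanSize k r b)) F :=
  Matrix.of fun x y =>
    if (x.1 : ℕ) = 0 ∧ (y.1 : ℕ) = r - 1 ∧ (x.2 : ℕ) = y.2 + 1 then 1 else 0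

theorem exists_equiv_alphaMat (F : Type*) [Field F] {k r : ℕ} (hk : 2 ≤ k) (hr : 2 ≤ r) :
    ∃ e : (Σ b, Fin (jordanSize k r b)) ≃ Fin (k * r),
      (alphaMat F k r).submatrix e e = blockShift F (jordanSize k r) 1 + mergeEntry F k r := by
  let row : (Σ b, Fin (jordanSize k r b)) → ℕ := fun x =>
    if (x.1 : ℕ) = 0 ∧ (x.2 : ℕ) = k then k - 1 else x.2
  let col : (Σ b, Fin (jordanSize k r b)) → ℕ := fun x =>
    if (x.1 : ℕ) = 0 then (if (x.2 : ℕ) = k then 1 else 0)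
    else if (x.1 : ℕ) = r - 1 then 1 else x.1 + 1
  have hrow : ∀ x, row x < k := by
    intro x
    obtain ⟨hx, hx'⟩ := jordanSize_cases x
    simp only [row]
    split_ifs <;> omega
  have hcol : ∀ x, col x < r := by
    intro x
    obtain ⟨hx, hx'⟩ := jordanSize_cases x
    simp only [col]
    split_ifs <;> omega
  have hinj : ∀ x y, row x * r + col x = row y * r + col y → x = y := by
    intro x y hxy
    rw [mul_add_inj_of_lt (hcol x) (hcol y)] at hxy
    rw [sigmaFin_ext_iff, Fin.ext_iff]
    obtain ⟨hx, hx'⟩ := jordanSize_cases x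
    obtain ⟨hy, hy'⟩ := jordanSize_cases y
    simp only [row, col] at hxy
    grind
  obtain ⟨e, he⟩ := exists_equiv_of_jordanSize (by omega) hr (fun x => row x * r + col x)
    (fun x => mul_add_lt_mul (hrow x) (hcol x)) hinj
  refine ⟨e, ?_⟩
  ext x y
  have hcond : (((e x : ℕ) = r ∧ (e y : ℕ) = 0) ∨ (r + 1 ≤ (e x : ℕ) ∧ (e x : ℕ) = e y + r) ∨
      ((e x : ℕ) = 1 + (k - 1) * r ∧ (e y : ℕ) = (k - 1) * r)) ↔
      (row x = row y + 1 ∧ col x = col y) ∨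
        (row x = k - 1 ∧ col x = 1) ∧ (row y = k - 1 ∧ col y = 0) := by
    have h1 : (e x : ℕ) = e y + r ↔ row x = row y + 1 ∧ col x = col y := by
      rw [he, he, ← mul_add_inj_of_lt (hcol x) (hcol y), add_mul]
      omega
    have h2 : (e x : ℕ) = 1 + (k - 1) * r ↔ row x = k - 1 ∧ col x = 1 := by
      rw [he, ← mul_add_inj_of_lt (hcol x) (show 1 < r by omega)]
      omega
    have h3 : (e y : ℕ) = (k - 1) * r ↔ row y = k - 1 ∧ col y = 0 := by
      rw [he, ← mul_add_inj_of_lt (hcol y) (show 0 < r by omega), add_zero]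
    rw [← h1, ← h2, ← h3]
    omega
  simp only [submatrix_apply, alphaMat, of_apply, hcond, Matrix.add_apply, blockShift, mergeEntry,
    Fin.ext_iff]
  obtain ⟨hx, hx'⟩ := jordanSize_cases x
  obtain ⟨hy, hy'⟩ := jordanSize_cases y
  have hiff : ((row x = row y + 1 ∧ col x = col y) ∨
        (row x = k - 1 ∧ col x = 1) ∧ (row y = k - 1 ∧ col y = 0)) ↔
      ((x.1 : ℕ) = y.1 ∧ (x.2 : ℕ) = y.2 + 1) ∨
      (((x.1 : ℕ) = 0 ∧ (x.2 : ℕ) = k) ∧ ((y.1 : ℕ) = r - 1 ∧ (y.2 : ℕ) = k - 2)) := by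
    simp only [row, col]
    grind
  simp only [hiff]
  by_cases h1 : (x.1 : ℕ) = y.1 ∧ (x.2 : ℕ) = y.2 + 1
  · rw [if_pos (Or.inl h1), if_pos h1, if_neg (by omega), add_zero]
  · simp only [h1, false_or, if_false, zero_add]

theorem mergeMap_mul_apply (F : Type*) [Field F] {k r : ℕ} {m : Type*}
    (M : Matrix m (Σ b, Fin (jordanSize k r b)) F) (p : m) (y : Σ b, Fin (jordanSize k r b)) :
    (∀ z : Σ b, Fin (jordanSize k r b), (y.1 : ℕ) = r - 1 → (z.1 : ℕ) = 0 →
      (z.2 : ℕ) = y.2 + 1 → (M * mergeMap F k r) p y = M p z) ∧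
    ((y.1 : ℕ) ≠ r - 1 → (M * mergeMap F k r) p y = 0) := by
  refine ⟨fun z hy hz hzy => ?_, fun hy => ?_⟩
  · rw [Matrix.mul_apply, Finset.sum_eq_single z]
    · simp [mergeMap, hy, hz, hzy]
    · intro x _ hx
      rw [ne_eq, sigmaFin_ext_iff, Fin.ext_iff] at hx
      simp only [mergeMap, of_apply]
      rw [if_neg (by omega), mul_zero]
    · simp
  · rw [Matrix.mul_apply]
    refine Finset.sum_eq_zero fun x _ => ?_
    simp [mergeMap, hy]

theorem exists_mergeMap_target {k r : ℕ} (hr : 2 ≤ r) (y : Σ b, Fin (jordanSize k r b))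
    (hy : (y.1 : ℕ) = r - 1) :
    ∃ z : Σ b, Fin (jordanSize k r b), (z.1 : ℕ) = 0 ∧ (z.2 : ℕ) = y.2 + 1 := by
  obtain ⟨_, hy'⟩ := jordanSize_cases y
  have h : (y.2 : ℕ) + 1 < jordanSize k r ⟨0, by omega⟩ := by
    simp only [jordanSize, if_true]
    omega
  exact ⟨⟨⟨0, by omega⟩, ⟨y.2 + 1, h⟩⟩, rfl, rfl⟩

theorem mergeMap_mul_self (F : Type*) [Field F] {k r : ℕ} (hr : 2 ≤ r) :
    mergeMap F k r * mergeMap F k r = 0 := by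
  ext x y
  obtain ⟨h1, h2⟩ := mergeMap_mul_apply F (mergeMap F k r) x y
  by_cases hy : (y.1 : ℕ) = r - 1
  · obtain ⟨z, hz, hzy⟩ := exists_mergeMap_target hr y hy
    rw [h1 z hy hz hzy]
    simp only [mergeMap, of_apply, Matrix.zero_apply]
    rw [if_neg (by omega)]
  · rw [h2 hy, Matrix.zero_apply]

theorem blockShift_add_mergeEntry_mul (F : Type*) [Field F] {k r : ℕ} (hk : 2 ≤ k) (hr : 2 ≤ r) :
    (blockShift F (jordanSize k r) 1 + mergeEntry F k r) * (1 - mergeMap F k r) =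
      (1 - mergeMap F k r) * blockShift F (jordanSize k r) 1 := by
  have hE : mergeEntry F k r * mergeMap F k r = 0 := by
    ext x y
    obtain ⟨h1, h2⟩ := mergeMap_mul_apply F (mergeEntry F k r) x y
    by_cases hy : (y.1 : ℕ) = r - 1
    · obtain ⟨z, hz, hzy⟩ := exists_mergeMap_target hr y hy
      rw [h1 z hy hz hzy]
      simp only [mergeEntry, of_apply, Matrix.zero_apply]
      rw [if_neg (by omega)]
    · rw [h2 hy, Matrix.zero_apply]
  have hN : blockShift F (jordanSize k r) 1 * mergeMap F k r =
      mergeMap F k r * blockShift F (jordanSize k r) 1 + mergeEntry F k r := by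
    ext x y
    rw [Matrix.add_apply, mul_blockShift_apply]
    obtain ⟨h1, h2⟩ := mergeMap_mul_apply F (blockShift F (jordanSize k r) 1) x y
    obtain ⟨hx, hx'⟩ := jordanSize_cases x
    obtain ⟨_, hy'⟩ := jordanSize_cases y
    by_cases hy : (y.1 : ℕ) = r - 1
    · obtain ⟨z, hz, hzy⟩ := exists_mergeMap_target hr y hy
      have hs : jordanSize k r y.1 = k - 1 := by
        simp only [jordanSize]
        rw [if_neg (by omega), if_pos hy]
      rw [h1 z hy hz hzy]
      simp only [blockShift, mergeMap, mergeEntry, of_apply, hs, hz, hzy, hy, Fin.ext_iff, true_and]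
      split_ifs <;> first | (exfalso; omega) | simp
    · rw [h2 hy]
      simp [mergeMap, mergeEntry, hy]
  rw [add_mul, mul_sub, mul_sub, hE, hN, sub_mul, mul_one, mul_one, one_mul]
  abel

theorem alphaMat_jordan_type (F : Type*) [Field F] (k r : ℕ) (hk : 2 ≤ k) (hr : 2 ≤ r) :
    (∃ g : (Matrix (Fin (k * r)) (Fin (k * r)) F)ˣ,
      (g : Matrix (Fin (k * r)) (Fin (k * r)) F) * alphaMat F k r *
        ((g⁻¹ : (Matrix (Fin (k * r)) (Fin (k * r)) F)ˣ) :
          Matrix (Fin (k * r)) (Fin (k * r)) F) = jordanDiagMat F k r) ∧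
    (∀ j : ℕ, 1 ≤ j →
      (alphaMat F k r ^ j).rank = (k + 1 - j) + (r - 2) * (k - j) + (k - 1 - j)) := by
  obtain ⟨e₁, h₁⟩ := exists_equiv_jordanDiagMat F hk hr
  obtain ⟨e₂, h₂⟩ := exists_equiv_alphaMat F hk hr
  have hM := mergeMap_mul_self F (k := k) hr
  have hU := blockShift_add_mergeEntry_mul F hk hr
  rw [← h₂, ← h₁] at hU
  have hV : (1 + mergeMap F k r) * (1 - mergeMap F k r) = 1 := by
    simp [mul_sub, add_mul, hM]
  have hV' : (1 - mergeMap F k r) * (1 + mergeMap F k r) = 1 := by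
    simp [sub_mul, mul_add, hM]
  have hconj : ∃ g : (Matrix (Fin (k * r)) (Fin (k * r)) F)ˣ,
      (g : Matrix (Fin (k * r)) (Fin (k * r)) F) * alphaMat F k r *
        ((g⁻¹ : (Matrix (Fin (k * r)) (Fin (k * r)) F)ˣ) :
          Matrix (Fin (k * r)) (Fin (k * r)) F) = jordanDiagMat F k r := by
    refine ⟨⟨(1 + mergeMap F k r).submatrix e₁.symm e₂.symm,
      (1 - mergeMap F k r).submatrix e₂.symm e₁.symm, ?_, ?_⟩, ?_⟩
    · rw [submatrix_mul_equiv, hV, submatrix_one_equiv]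
    · rw [submatrix_mul_equiv, hV', submatrix_one_equiv]
    · have ha : alphaMat F k r =
          ((alphaMat F k r).submatrix e₂ e₂).submatrix e₂.symm e₂.symm := by simp
      have hj : jordanDiagMat F k r =
          ((jordanDiagMat F k r).submatrix e₁ e₁).submatrix e₁.symm e₁.symm := by simp
      rw [Units.inv_mk, ha, hj, submatrix_mul_equiv, submatrix_mul_equiv, mul_assoc, hU,
        ← mul_assoc, hV, one_mul]
  refine ⟨hconj, fun j _ => ?_⟩
  obtain ⟨g, hg⟩ := hconj
  have hpow : jordanDiagMat F k r ^ j = (g : Matrix (Fin (k * r)) (Fin (k * r)) F) *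
      alphaMat F k r ^ j * ((g⁻¹ : (Matrix (Fin (k * r)) (Fin (k * r)) F)ˣ) :
          Matrix (Fin (k * r)) (Fin (k * r)) F) := by
    rw [← hg, Units.conj_pow]
  have hrank : (alphaMat F k r ^ j).rank = (jordanDiagMat F k r ^ j).rank := by
    rw [hpow, rank_mul_eq_left_of_isUnit_det _ _ ((isUnit_iff_isUnit_det _).1 g⁻¹.isUnit),
      rank_mul_eq_right_of_isUnit_det _ _ ((isUnit_iff_isUnit_det _).1 g.isUnit)]
  have hsub : (jordanDiagMat F k r ^ j).submatrix e₁ e₁ = blockShift F (jordanSize k r) j := by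
    rw [← blockShift_one_pow, ← h₁]
    exact map_pow (reindexAlgEquiv F F e₁.symm) (jordanDiagMat F k r) j
  rw [hrank, ← rank_submatrix (jordanDiagMat F k r ^ j) e₁ e₁, hsub, rank_blockShift,
    sum_jordanSize_sub k r j hr]
end
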